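/- For every integer n ≥ 3, the cycle graph C_n on n vertices satisfies: w(C_n) = 2^{n-1} if n is odd, and w(C_n) = 2^{n-1} − 2^{n/2} if n is even. -/

import Mathlib

/-- The quadratic Boolean form associated with a graph `G`:
`f_G(x) = ∑_{{i,j} ∈ E(G)} x_i x_j` over `F₂ = ZMod 2`. -/
noncomputable def quadForm {V : Type*} [Fintype V] (G : SimpleGraph V)
    (x : V → ZMod 2) : ZMod 2 := by
  classical
  exact ∑ e ∈ G.edgeFinset,
    Sym2.lift ⟨fun i j => x i * x j, fun a b => mul_comm (x a) (x b)⟩ e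

/-- The MS-number `w(G)`: the number of `x ∈ F₂^V` with `f_G(x) = 1`. -/
noncomputable def msNumber {V : Type*} [Fintype V] (G : SimpleGraph V) : ℕ := by
  classical
  exact (Finset.univ.filter fun x : V → ZMod 2 => quadForm G x = 1).card

/-- The binary rank of a graph: the rank of its adjacency matrix over `F₂`. -/
noncomputable def brank {V : Type*} [Fintype V] [DecidableEq V]
    (G : SimpleGraph V) : ℕ := by
  classical
  exact (SimpleGraph.adjMatrix (ZMod 2) G).rank

/-- The transfer matrix expansion: weighted sums over walks of length `n` are sums over entries
of the `n`-th matrix power. -/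
theorem Matrix.sum_walk_eq_sum_pow {ι R : Type*} [Fintype ι] [DecidableEq ι] [CommRing R]
    (M : Matrix ι ι R) (n : ℕ) (F : ι → ι → R) :
    ∑ x : Fin (n + 1) → ι, F (x 0) (x (Fin.last n)) * ∏ i : Fin n, M (x i.castSucc) (x i.succ) =
      ∑ a, ∑ b, F a b * (M ^ n) a b := by
  induction n generalizing F with
  | zero =>
    rw [← (Equiv.funUnique (Fin 1) ι).symm.sum_comp]
    simp [Matrix.one_apply]
  | succ n ih =>
    rw [← (Fin.consEquiv fun _ : Fin (n + 2) => ι).sum_comp, Fintype.sum_prod_type]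
    refine Finset.sum_congr rfl fun a _ => ?_
    have h := ih fun c b => F a b * M a c
    calc _ = ∑ y : Fin (n + 1) → ι, F a (y (Fin.last n)) * M a (y 0) *
          ∏ i : Fin n, M (y i.castSucc) (y i.succ) := by
            refine Finset.sum_congr rfl fun y _ => ?_
            simp [Fin.consEquiv, Fin.prod_univ_succ, Fin.castSucc_succ, mul_assoc,
              -Fin.succ_last]
      _ = _ := by
            rw [h, Finset.sum_comm]
            refine Finset.sum_congr rfl fun b _ => ?_
            rw [pow_succ', Matrix.mul_apply, Finset.mul_sum]
            exact Finset.sum_congr rfl fun c _ => mul_assoc _ _ _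

/-- Weighted closed walks are counted by the trace of a matrix power. -/
theorem Matrix.sum_closed_walk_eq_trace_pow {ι R : Type*} [Fintype ι] [DecidableEq ι] [CommRing R]
    (M : Matrix ι ι R) (n : ℕ) :
    ∑ x : Fin (n + 1) → ι, ∏ i, M (x i) (x (i + 1)) = (M ^ (n + 1)).trace := by
  have h := M.sum_walk_eq_sum_pow n fun a b => M b a
  simp only [Fin.prod_univ_castSucc, Fin.coeSucc_eq_succ, Fin.last_add_one]
  simp only [mul_comm (∏ _, _)]
  rw [h, Finset.sum_comm, pow_succ', Matrix.trace]
  simp [Matrix.mul_apply]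

theorem quadForm_cycleGraph (n : ℕ) (x : Fin (n + 3) → ZMod 2) :
    quadForm (SimpleGraph.cycleGraph (n + 3)) x = ∑ i, x i * x (i + 1) := by
  classical
  unfold quadForm
  symm
  refine Finset.sum_bij (fun i _ => s(i, i + 1)) ?_ ?_ ?_ ?_
  · intro i _
    simp [SimpleGraph.cycleGraph_adj]
  · intro i _ j _ h
    rcases Sym2.eq_iff.1 h with h | ⟨h, h'⟩
    · exact h.1
    · have h2 : (1 + 1 : Fin (n + 3)) = 0 := by
        rw [h, add_assoc] at h'
        simpa using h'
      have := congrArg Fin.val h2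
      simp [Fin.val_add, Nat.mod_eq_of_lt] at this
  · intro e
    induction e with
    | h u v =>
      intro h
      simp only [SimpleGraph.mem_edgeFinset, SimpleGraph.mem_edgeSet,
        SimpleGraph.cycleGraph_adj] at h
      rcases h with h | h
      · exact ⟨v, Finset.mem_univ _, by rw [← h, add_sub_cancel, Sym2.eq_swap]⟩
      · exact ⟨u, Finset.mem_univ _, by rw [← h, add_sub_cancel]⟩
  · intro i _
    rfl

/-- The nontrivial additive character of `ZMod 2`, with integer values. -/
def signChar (a : ZMod 2) : ℤ := if a = 1 then -1 else 1

theorem signChar_sum {ι : Type*} (s : Finset ι) (f : ι → ZMod 2) :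
    signChar (∑ i ∈ s, f i) = ∏ i ∈ s, signChar (f i) := by
  classical
  have hadd : ∀ a b, signChar (a + b) = signChar a * signChar b := by decide
  induction s using Finset.induction_on with
  | empty => simp [signChar]
  | insert a s ha ih => rw [Finset.sum_insert ha, Finset.prod_insert ha, hadd, ih]

/-- The Hadamard matrix of order two, indexed by `ZMod 2`. -/
def signMatrix : Matrix (ZMod 2) (ZMod 2) ℤ := Matrix.of fun a b => signChar (a * b)

theorem signMatrix_sq : signMatrix ^ 2 = (2 : ℤ) • 1 := by
  rw [sq]
  ext a b
  revert a b
  decide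

theorem signMatrix_pow_two_mul (k : ℕ) : signMatrix ^ (2 * k) = (2 ^ k : ℤ) • 1 := by
  rw [pow_mul, signMatrix_sq, smul_pow, one_pow]

theorem sum_signChar_quadForm {V : Type*} [Fintype V] [DecidableEq V] (G : SimpleGraph V) :
    ∑ x : V → ZMod 2, signChar (quadForm G x) = 2 ^ Fintype.card V - 2 * msNumber G := by
  classical
  have h : ∀ a, signChar a = 1 - 2 * if a = 1 then 1 else 0 := by decide
  simp only [h, Finset.sum_sub_distrib, ← Finset.mul_sum, Finset.sum_boole]
  simp [msNumber]
  congr!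

theorem two_mul_msNumber_cycleGraph (n : ℕ) :
    (2 * msNumber (SimpleGraph.cycleGraph (n + 3)) : ℤ) =
      2 ^ (n + 3) - (signMatrix ^ (n + 3)).trace := by
  have h := sum_signChar_quadForm (SimpleGraph.cycleGraph (n + 3))
  simp only [quadForm_cycleGraph, signChar_sum, Fintype.card_fin] at h
  have h' := signMatrix.sum_closed_walk_eq_trace_pow (n + 2)
  simp only [signMatrix, Matrix.of_apply] at h' ⊢
  rw [← h', h]
  ring

theorem msNumber_cycle {n : ℕ} (hn : 3 ≤ n) :
    (Odd n → msNumber (SimpleGraph.cycleGraph n) = 2 ^ (n - 1)) ∧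
      (Even n → msNumber (SimpleGraph.cycleGraph n) = 2 ^ (n - 1) - 2 ^ (n / 2)) := by
  obtain ⟨m, rfl⟩ := Nat.exists_eq_add_of_le' hn
  have h := two_mul_msNumber_cycleGraph m
  constructor
  · rintro ⟨k, hk⟩
    have ht : signMatrix.trace = 0 := by decide
    rw [hk] at h ⊢
    rw [pow_succ signMatrix, signMatrix_pow_two_mul, Matrix.smul_mul, one_mul, Matrix.trace_smul,
      ht, smul_zero, sub_zero, pow_succ'] at h
    rw [Nat.add_sub_cancel]
    exact_mod_cast mul_left_cancel₀ two_ne_zero h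
  · rintro ⟨k, hk⟩
    rw [← two_mul] at hk
    rw [hk] at h ⊢
    rw [signMatrix_pow_two_mul, Matrix.trace_smul, Matrix.trace_one, ZMod.card, smul_eq_mul] at h
    have hp : (2 : ℤ) ^ (2 * k) = 2 * 2 ^ (2 * k - 1) := by
      rw [← pow_succ', Nat.sub_add_cancel (by lia)]
    rw [hp] at h
    rw [Nat.mul_div_cancel_left k two_pos]
    zify [Nat.pow_le_pow_right two_pos (show k ≤ 2 * k - 1 by lia)]
    push_cast at h
    linarith
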